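/- Fix reals a ≥ 0 and 0 ≤ α ≤ β, and set μ_n(x) = (n/(n+β))·x + (a/(n+β))·x/(1+x) + (2α+1)/(2(n+β)) and γ_n(x) = T_{n,a}^{α,β}((t−x)²;x) + (μ_n(x) − x)². There exists a constant K > 0 (independent of f, n and x) such that for every bounded continuous f : [0,∞) → ℝ, every integer n ≥ 1 and every x ≥ 0: |T_{n,a}^{α,β}(f;x) − f(x)| ≤ K·ω₂(f; √(γ_n(x))) + ω(f; (β/(n+β))·x + (a/(n+β))·x/(1+x) + (2α+1)/(2(n+β))). -/

import Mathlib

open MeasureTheory Filter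

/-- Rising factorial `(n)_i = n(n+1)⋯(n+i−1)`, with `(n)_0 = 1`. -/
noncomputable def risingFac (n i : ℕ) : ℝ := ∏ j ∈ Finset.range i, ((n : ℝ) + j)

/-- `p_k(n,a) = Σ_{i=0}^{k} C(k,i)·(n)_i·a^{k−i}`. -/
noncomputable def pCoef (n : ℕ) (a : ℝ) (k : ℕ) : ℝ :=
  ∑ i ∈ Finset.range (k + 1), (Nat.choose k i : ℝ) * risingFac n i * a ^ (k - i)

/-- Generalized Baskakov basis function `W_{n,k}^a(x)`. -/
noncomputable def W (n : ℕ) (a : ℝ) (k : ℕ) (x : ℝ) : ℝ :=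
  Real.exp (-(a * x) / (1 + x)) * (pCoef n a k / (Nat.factorial k : ℝ)) * x ^ k /
    (1 + x) ^ (k + n)

/-- Stancu-type operator `L_{n,a}^{α,β}(f;x) = Σ_k W_{n,k}^a(x) f((k+α)/(n+β))`. -/
noncomputable def Lop (n : ℕ) (a α β : ℝ) (f : ℝ → ℝ) (x : ℝ) : ℝ :=
  ∑' k : ℕ, W n a k x * f (((k : ℝ) + α) / ((n : ℝ) + β))

/-- Generalized Baskakov–Kantorovich–Stancu operator `T_{n,a}^{α,β}(f;x)`. -/
noncomputable def TKS (n : ℕ) (a α β : ℝ) (f : ℝ → ℝ) (x : ℝ) : ℝ :=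
  ((n : ℝ) + β) *
    ∑' k : ℕ, W n a k x *
      ∫ t in (((k : ℝ) + α) / ((n : ℝ) + β))..(((k : ℝ) + α + 1) / ((n : ℝ) + β)), f t
/-- First modulus of continuity on `[0,∞)`. -/
noncomputable def omega1 (f : ℝ → ℝ) (δ : ℝ) : ℝ :=
  sSup {y | ∃ h x : ℝ, 0 < h ∧ h ≤ δ ∧ 0 ≤ x ∧ y = |f (x + h) - f x|}

/-- Second modulus of continuity on `[0,∞)`. -/
noncomputable def omega2 (f : ℝ → ℝ) (δ : ℝ) : ℝ :=
  sSup {y | ∃ h x : ℝ, 0 < h ∧ h ≤ δ ∧ 0 ≤ x ∧ y = |f (x + 2 * h) - 2 * f (x + h) + f x|}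

/-- Weighted modulus of continuity `Ω(f;δ)`. -/
noncomputable def OmegaW (f : ℝ → ℝ) (δ : ℝ) : ℝ :=
  sSup {y | ∃ h x : ℝ, 0 < h ∧ h ≤ δ ∧ 0 ≤ x ∧
    y = |f (x + h) - f x| / ((1 + h ^ 2) * (1 + x ^ 2))}

lemma risingFac_div (n i : ℕ) : risingFac (n+1) i / (Nat.factorial i : ℝ) = ((i + n).choose n : ℝ) := by
  have h : risingFac (n+1) i = ((n+1).ascFactorial i : ℝ) := by
    induction i with
    | zero => simp [risingFac]
    | succ i ih =>
      rw [Nat.ascFactorial_succ]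
      unfold risingFac at *
      rw [Finset.prod_range_succ, ih]; push_cast; ring
  rw [h, Nat.ascFactorial_eq_factorial_mul_choose]
  have : (n + i).choose i = (i+n).choose n := by
    rw [add_comm n i]; exact Nat.choose_symm_add
  push_cast
  rw [this]
  have := Nat.factorial_ne_zero i
  field_simp

lemma risingFac_nonneg (n i : ℕ) : 0 ≤ risingFac n i := by
  unfold risingFac; positivity

lemma hasSum_u (n : ℕ) (hn : 1 ≤ n) (z : ℝ) (h0 : 0 ≤ z) (h1 : z < 1) :
    HasSum (fun i => risingFac n i / (Nat.factorial i : ℝ) * z ^ i) (1 / (1 - z) ^ n) := by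
  obtain ⟨m, rfl⟩ : ∃ m, n = m + 1 := ⟨n - 1, by omega⟩
  simp_rw [risingFac_div]
  exact hasSum_choose_mul_geometric_of_norm_lt_one m (by rwa [Real.norm_of_nonneg h0])

lemma risingFac_succ (n i : ℕ) : risingFac n (i+1) = n * risingFac (n+1) i := by
  unfold risingFac
  rw [Finset.prod_range_succ']
  push_cast
  rw [mul_comm, add_zero]
  congr 1
  apply Finset.prod_congr rfl; intros; ring

lemma hasSum_u1 (n : ℕ) (z : ℝ) (h0 : 0 ≤ z) (h1 : z < 1) :
    HasSum (fun i : ℕ => (i : ℝ) * (risingFac n i / (Nat.factorial i : ℝ) * z ^ i))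
      (n * z * (1 / (1 - z) ^ (n+1))) := by
  rw [← hasSum_nat_add_iff' 1]
  simp only [Finset.sum_range_one, Nat.cast_zero, zero_mul, sub_zero]
  have := (hasSum_u (n+1) (by omega) z h0 h1).mul_left (n * z)
  refine this.congr_fun ?_
  intro i
  rw [risingFac_succ, Nat.factorial_succ, pow_succ]
  have := Nat.factorial_ne_zero i
  push_cast
  field_simp

lemma hasSum_v (b : ℝ) : HasSum (fun j : ℕ => b ^ j / (Nat.factorial j : ℝ)) (Real.exp b) := by
  rw [Real.exp_eq_exp_ℝ]; exact NormedSpace.expSeries_div_hasSum_exp b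

lemma hasSum_v1 (b : ℝ) : HasSum (fun j : ℕ => (j : ℝ) * (b ^ j / (Nat.factorial j : ℝ))) (b * Real.exp b) := by
  rw [← hasSum_nat_add_iff' 1]
  simp only [Finset.sum_range_one, Nat.cast_zero, zero_mul, sub_zero]
  have := (hasSum_v b).mul_left b
  refine this.congr_fun ?_ 
  intro i
  rw [Nat.factorial_succ, pow_succ]
  have := Nat.factorial_ne_zero i
  push_cast
  field_simp

lemma hasSum_conv (p q : ℕ → ℝ) (P Q : ℝ) (hp : HasSum p P) (hq : HasSum q Q)
    (p0 : ∀ i, 0 ≤ p i) (q0 : ∀ i, 0 ≤ q i) :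
    HasSum (fun k => ∑ i ∈ Finset.range (k+1), p i * q (k - i)) (P * Q) := by
  have hp' : Summable (fun i => ‖p i‖) := by simpa only [Real.norm_of_nonneg (p0 _)] using hp.summable
  have hq' : Summable (fun i => ‖q i‖) := by simpa only [Real.norm_of_nonneg (q0 _)] using hq.summable
  have := hasSum_sum_range_mul_of_summable_norm hp' hq'
  rwa [hp.tsum_eq, hq.tsum_eq] at this

lemma pCoef_term (n k : ℕ) (a z : ℝ) : pCoef n a k / (Nat.factorial k : ℝ) * z ^ k =
    ∑ i ∈ Finset.range (k+1), (risingFac n i / (Nat.factorial i : ℝ) * z ^ i) *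
      ((a*z) ^ (k-i) / (Nat.factorial (k-i) : ℝ)) := by
  unfold pCoef
  rw [Finset.sum_div, Finset.sum_mul]
  apply Finset.sum_congr rfl
  intro i hi
  have hi : i ≤ k := by simp at hi; omega
  rw [Nat.cast_choose ℝ hi, mul_pow]
  have h : z ^ k = z^i * z^(k-i) := by rw [← pow_add]; congr 1; omega
  rw [h]
  have := Nat.factorial_ne_zero i
  have := Nat.factorial_ne_zero k
  have := Nat.factorial_ne_zero (k-i)
  field_simp

lemma pCoef_nonneg (n k : ℕ) (a : ℝ) (ha : 0 ≤ a) : 0 ≤ pCoef n a k := by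
  unfold pCoef
  apply Finset.sum_nonneg; intro i _
  have := risingFac_nonneg n i
  positivity

lemma hasSum_c (n : ℕ) (hn : 1 ≤ n) (a z : ℝ) (ha : 0 ≤ a) (h0 : 0 ≤ z) (h1 : z < 1) :
    HasSum (fun k => pCoef n a k / (Nat.factorial k : ℝ) * z ^ k)
      (1 / (1 - z) ^ n * Real.exp (a*z)) := by
  simp_rw [pCoef_term]
  apply hasSum_conv (fun i => risingFac n i / (Nat.factorial i : ℝ) * z ^ i)
    (fun j => (a*z) ^ j / (Nat.factorial j : ℝ)) _ _ (hasSum_u n hn z h0 h1) (hasSum_v _)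
  · intro i; have := risingFac_nonneg n i; positivity
  · intro i; positivity

lemma hasSum_c1 (n : ℕ) (hn : 1 ≤ n) (a z : ℝ) (ha : 0 ≤ a) (h0 : 0 ≤ z) (h1 : z < 1) :
    HasSum (fun k : ℕ => (k : ℝ) * (pCoef n a k / (Nat.factorial k : ℝ) * z ^ k))
      ((n * z * (1 / (1 - z) ^ (n+1))) * Real.exp (a*z) +
        1 / (1 - z) ^ n * (a * z * Real.exp (a*z))) := by
  have u0 : ∀ i, 0 ≤ risingFac n i / (Nat.factorial i : ℝ) * z ^ i := by
    intro i; have := risingFac_nonneg n i; positivity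
  have v0 : ∀ j, 0 ≤ (a*z) ^ j / (Nat.factorial j : ℝ) := by intro i; positivity
  have A := hasSum_conv _ _ _ _ (hasSum_u1 n z h0 h1) (hasSum_v (a*z))
    (fun i => mul_nonneg (Nat.cast_nonneg i) (u0 i)) v0
  have B := hasSum_conv _ _ _ _ (hasSum_u n hn z h0 h1) (hasSum_v1 (a*z)) u0
    (fun i => mul_nonneg (Nat.cast_nonneg i) (v0 i))
  refine (A.add B).congr_fun ?_
  intro k
  rw [pCoef_term, Finset.mul_sum, ← Finset.sum_add_distrib]
  apply Finset.sum_congr rfl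
  intro i hi
  have hi : i ≤ k := by simp at hi; omega
  rw [Nat.cast_sub hi]; ring

lemma summable_c2 (n : ℕ) (hn : 1 ≤ n) (a z : ℝ) (ha : 0 ≤ a) (h0 : 0 ≤ z) (h1 : z < 1) :
    Summable (fun k : ℕ => (k : ℝ)^2 * (pCoef n a k / (Nat.factorial k : ℝ) * z ^ k)) := by
  set y := (z+1)/2 with hy
  have hy0 : 0 < y := by rw [hy]; linarith
  have hs := (hasSum_c n hn a y ha hy0.le (by rw [hy]; linarith)).summable
  have ht := tendsto_pow_const_mul_const_pow_of_lt_one 2 (r := z / y) (by positivity)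
    (by rw [div_lt_one hy0, hy]; linarith)
  obtain ⟨B, hB⟩ := ht.bddAbove_range
  have hB' : ∀ k : ℕ, (k:ℝ)^2 * (z/y)^k ≤ B := fun k => hB ⟨k, rfl⟩
  refine Summable.of_nonneg_of_le ?_ ?_ (hs.mul_left B)
  · intro k; have := pCoef_nonneg n k a ha; positivity
  · intro k
    have := pCoef_nonneg n k a ha
    have e : (k : ℝ)^2 * (pCoef n a k / (Nat.factorial k : ℝ) * z ^ k) =
      ((k:ℝ)^2 * (z/y)^k) * (pCoef n a k / (Nat.factorial k : ℝ) * y ^ k) := by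
      rw [div_pow]; field_simp
    rw [e]
    exact mul_le_mul_of_nonneg_right (hB' k) (by positivity)

lemma W_eq (n : ℕ) (a : ℝ) (k : ℕ) (x : ℝ) (hx : 0 ≤ x) :
    W n a k x = (Real.exp (-(a * (x/(1+x)))) * (1 - x/(1+x))^n) *
      (pCoef n a k / (Nat.factorial k : ℝ) * (x/(1+x))^k) := by
  unfold W
  have : 1 - x/(1+x) = 1/(1+x) := by field_simp; ring
  rw [this, div_pow, div_pow, pow_add, one_pow, neg_div, mul_div_assoc a]
  field_simp

lemma zfacts (x : ℝ) (hx : 0 ≤ x) : 0 ≤ x/(1+x) ∧ x/(1+x) < 1 := by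
  refine ⟨by positivity, ?_⟩
  rw [div_lt_one (by positivity)]; linarith

lemma W_nonneg (n : ℕ) (a : ℝ) (ha : 0 ≤ a) (k : ℕ) (x : ℝ) (hx : 0 ≤ x) : 0 ≤ W n a k x := by
  have := pCoef_nonneg n k a ha
  unfold W; positivity

lemma hasSum_W (n : ℕ) (hn : 1 ≤ n) (a : ℝ) (ha : 0 ≤ a) (x : ℝ) (hx : 0 ≤ x) :
    HasSum (fun k => W n a k x) 1 := by
  obtain ⟨h0, h1⟩ := zfacts x hx
  simp_rw [fun k => W_eq n a k x hx]
  have := (hasSum_c n hn a _ ha h0 h1).mul_left (Real.exp (-(a * (x/(1+x)))) * (1 - x/(1+x))^n)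
  have e : (Real.exp (-(a * (x/(1+x)))) * (1 - x/(1+x))^n) *
      (1 / (1 - x/(1+x)) ^ n * Real.exp (a*(x/(1+x)))) = 1 := by
    have : 1 - x/(1+x) ≠ 0 := by linarith
    generalize x/(1+x) = z at *
    rw [Real.exp_neg]
    field_simp
  rw [e] at this
  exact this

lemma hasSum_W1 (n : ℕ) (hn : 1 ≤ n) (a : ℝ) (ha : 0 ≤ a) (x : ℝ) (hx : 0 ≤ x) :
    HasSum (fun k : ℕ => (k : ℝ) * W n a k x) (n * x + a * (x/(1+x))) := by
  obtain ⟨h0, h1⟩ := zfacts x hx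
  simp_rw [fun k => W_eq n a k x hx]
  have := (hasSum_c1 n hn a _ ha h0 h1).mul_left (Real.exp (-(a * (x/(1+x)))) * (1 - x/(1+x))^n)
  have h : 1 - x/(1+x) ≠ 0 := by linarith
  have hx' : x = x/(1+x) / (1 - x/(1+x)) := by
    have : 1 - x/(1+x) = 1/(1+x) := by field_simp; ring
    rw [this]; field_simp
  generalize x/(1+x) = z at *
  have e : (Real.exp (-(a * z)) * (1 - z)^n) * ((n * z * (1 / (1 - z) ^ (n+1))) * Real.exp (a*z) +
        1 / (1 - z) ^ n * (a * z * Real.exp (a*z))) = n * x + a * z := by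
    rw [Real.exp_neg, hx']
    field_simp
    ring
  rw [e] at this
  refine this.congr_fun ?_
  intro k; ring

lemma summable_W2 (n : ℕ) (hn : 1 ≤ n) (a : ℝ) (ha : 0 ≤ a) (x : ℝ) (hx : 0 ≤ x) :
    Summable (fun k : ℕ => (k : ℝ)^2 * W n a k x) := by
  obtain ⟨h0, h1⟩ := zfacts x hx
  simp_rw [fun k => W_eq n a k x hx]
  have := (summable_c2 n hn a _ ha h0 h1).mul_left (Real.exp (-(a * (x/(1+x)))) * (1 - x/(1+x))^n)
  refine this.congr ?_
  intro k; ring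


/-- Steklov-type local linear approximation. -/
lemma steklov (f : ℝ → ℝ) (hf : ContinuousOn f (Set.Ici 0)) (h w : ℝ) (hh : 0 < h)
    (hw : ∀ s x : ℝ, 0 ≤ s → s ≤ h → 0 ≤ x → |f (x + 2 * s) - 2 * f (x + s) + f x| ≤ w)
    (m : ℝ) (hm : 0 ≤ m) :
    ∃ L : ℝ, ∀ t : ℝ, 0 ≤ t → |f t - f m - L * (t - m)| ≤ 2 * w + 9 * w / h^2 * (t - m)^2 := by
  set c := h / 2 with hc
  have hc0 : 0 < c := by positivity
  set g : ℝ → ℝ := fun t => f (max t 0) with hg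
  have gc : Continuous g := by
    apply hf.comp_continuous (by fun_prop)
    intro t; exact le_max_right t (0:ℝ)
  have ge : ∀ t, 0 ≤ t → g t = f t := fun t ht => by simp [hg, max_eq_left ht]
  set F1 : ℝ → ℝ := fun t => ∫ s in (0:ℝ)..t, g s with hF1
  have d1 : ∀ t, HasDerivAt F1 (g t) t := fun t =>
    intervalIntegral.integral_hasDerivAt_right (gc.intervalIntegrable _ _)
      gc.aestronglyMeasurable.stronglyMeasurableAtFilter gc.continuousAt
  have F1c : Continuous F1 := continuous_iff_continuousAt.2 fun t => (d1 t).continuousAt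
  set F2 : ℝ → ℝ := fun t => ∫ s in (0:ℝ)..t, F1 s with hF2
  have d2 : ∀ t, HasDerivAt F2 (F1 t) t := fun t =>
    intervalIntegral.integral_hasDerivAt_right (F1c.intervalIntegrable _ _)
      F1c.aestronglyMeasurable.stronglyMeasurableAtFilter F1c.continuousAt
  have i1 : ∀ p q, ∫ s in p..q, g s = F1 q - F1 p := fun p q =>
    intervalIntegral.integral_eq_sub_of_hasDerivAt (fun t _ => d1 t) (gc.intervalIntegrable _ _)
  have i2 : ∀ p q, ∫ s in p..q, F1 s = F2 q - F2 p := fun p q =>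
    intervalIntegral.integral_eq_sub_of_hasDerivAt (fun t _ => d2 t) (F1c.intervalIntegrable _ _)
  set D : (ℝ → ℝ) → ℝ → ℝ := fun φ t => (2 * (φ (t+2*c) - 2 * φ (t+c) + φ t) -
    1/4 * (φ (t+4*c) - 2 * φ (t+2*c) + φ t)) / c^2 with hD
  have dD : ∀ φ ψ : ℝ → ℝ, (∀ t, HasDerivAt φ (ψ t) t) → ∀ t, HasDerivAt (D φ) (D ψ t) t := by
    intro φ ψ hd t
    have e : ∀ r, HasDerivAt (fun t => φ (t + r)) (ψ (t + r)) t := fun r =>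
      (hd (t+r)).comp_add_const t r
    exact (((((e (2*c)).sub ((e c).const_mul 2)).add (hd t)).const_mul 2).sub
      ((((e (4*c)).sub ((e (2*c)).const_mul 2)).add (hd t)).const_mul (1/4))).div_const _
  have dG := dD F2 F1 d2
  have dG1 := dD F1 g d1
  have w0 : 0 ≤ w := (abs_nonneg _).trans (hw h 0 hh.le le_rfl le_rfl)
  -- second derivative bound
  have bG : ∀ t, 0 ≤ t → |D g t| ≤ 9 * w / h^2 := by
    intro t ht
    have A := abs_le.1 (hw c t hc0.le (by linarith) ht)
    have B := abs_le.1 (hw (2*c) t (by linarith) (by linarith) ht)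
    simp only [hD]
    rw [ge _ ht, ge (t + 2*c) (by linarith), ge (t + c) (by linarith), ge (t + 4*c) (by linarith)]
    rw [show t + 2 * (2*c) = t + 4*c by ring] at B
    rw [abs_div, abs_of_pos (show 0 < c^2 by positivity), div_le_div_iff₀ (by positivity) (by positivity),
      show h^2 = 4 * c^2 by rw [hc]; ring]
    have : |2 * (f (t+2*c) - 2 * f (t+c) + f t) -
    1/4 * (f (t+4*c) - 2 * f (t+2*c) + f t)| ≤ 9/4 * w := by
      rw [abs_le]; constructor <;> linarith [A.1, A.2, B.1, B.2]
    nlinarith [mul_le_mul_of_nonneg_right this (show 0 ≤ 4 * c^2 by positivity)]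
  -- approximation
  have ap : ∀ t, 0 ≤ t → |f t - D F2 t| ≤ w := by
    intro t ht
    have e1 : ∫ s in (0:ℝ)..c, ∫ u in (0:ℝ)..c, g (t + s + u) =
        F2 (t+2*c) - 2 * F2 (t+c) + F2 t := by
      simp_rw [intervalIntegral.integral_comp_add_left g, i1]
      have : ∀ s, F1 (t + s + c) - F1 (t + s + 0) = F1 ((t + c) + s) - F1 (t + s) := by
        intro s; rw [add_zero]; congr 2; ring
      simp_rw [this]
      rw [intervalIntegral.integral_sub ((by fun_prop : Continuous _).intervalIntegrable _ _)
        ((by fun_prop : Continuous _).intervalIntegrable _ _),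
        intervalIntegral.integral_comp_add_left F1, intervalIntegral.integral_comp_add_left F1, i2, i2]
      rw [show t + c + c = t + 2*c by ring, add_zero, add_zero]; ring
    have e2 : ∫ s in (0:ℝ)..c, ∫ u in (0:ℝ)..c, g (t + 2 * s + 2 * u) =
        1/4 * (F2 (t+4*c) - 2 * F2 (t+2*c) + F2 t) := by
      have : ∀ s, ∫ u in (0:ℝ)..c, g (t + 2 * s + 2 * u) =
          1/2 * (F1 ((t + 2*c) + 2 * s) - F1 (t + 2*s)) := by
        intro s
        rw [intervalIntegral.integral_comp_add_mul g two_ne_zero, i1, smul_eq_mul]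
        rw [show t + 2*s + 2*c = t + 2*c + 2*s by ring, mul_zero, add_zero]; norm_num
      simp_rw [this]
      rw [intervalIntegral.integral_const_mul, intervalIntegral.integral_sub ((by fun_prop : Continuous _).intervalIntegrable _ _)
        ((by fun_prop : Continuous _).intervalIntegrable _ _),
        intervalIntegral.integral_comp_add_mul F1 two_ne_zero, intervalIntegral.integral_comp_add_mul F1 two_ne_zero, i2, i2]
      rw [show t + 2*c + 2*c = t + 4*c by ring]
      simp only [mul_zero, add_zero, smul_eq_mul]; ring
    have e3 : ∫ s in (0:ℝ)..c, ∫ u in (0:ℝ)..c, (g (t + 2 * s + 2 * u) - 2 * g (t + s + u) + g t) =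
        c^2 * (f t - D F2 t) := by
      have : ∀ s, ∫ u in (0:ℝ)..c, (g (t + 2 * s + 2 * u) - 2 * g (t + s + u) + g t) =
          (∫ u in (0:ℝ)..c, g (t + 2 * s + 2 * u)) - 2 * (∫ u in (0:ℝ)..c, g (t + s + u)) + c * g t := by
        intro s
        rw [intervalIntegral.integral_add ((by fun_prop : Continuous _).intervalIntegrable _ _)
          ((by fun_prop : Continuous _).intervalIntegrable _ _),
          intervalIntegral.integral_sub ((by fun_prop : Continuous _).intervalIntegrable _ _)
          ((by fun_prop : Continuous _).intervalIntegrable _ _),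
          intervalIntegral.integral_const_mul]
        simp
      simp_rw [this]
      have c1 : Continuous fun s => ∫ u in (0:ℝ)..c, g (t + 2 * s + 2 * u) :=
        intervalIntegral.continuous_parametric_intervalIntegral_of_continuous' (by fun_prop) _ _
      have c2 : Continuous fun s => ∫ u in (0:ℝ)..c, g (t + s + u) :=
        intervalIntegral.continuous_parametric_intervalIntegral_of_continuous' (by fun_prop) _ _
      have c3 : Continuous fun s => (∫ u in (0:ℝ)..c, g (t + 2 * s + 2 * u)) -
          2 * ∫ u in (0:ℝ)..c, g (t + s + u) := c1.sub (c2.const_mul 2)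
      rw [intervalIntegral.integral_add (c3.intervalIntegrable _ _)
          (continuous_const.intervalIntegrable _ _),
          intervalIntegral.integral_sub (c1.intervalIntegrable _ _)
          ((c2.const_mul 2).intervalIntegrable _ _),
          intervalIntegral.integral_const_mul, e1, e2, ge t ht]
      simp only [intervalIntegral.integral_const, hD, smul_eq_mul]
      field_simp
      ring
    have e4 : ‖∫ s in (0:ℝ)..c, ∫ u in (0:ℝ)..c, (g (t + 2 * s + 2 * u) - 2 * g (t + s + u) + g t)‖
        ≤ (w * |c - 0|) * |c - 0| := by
      apply intervalIntegral.norm_integral_le_of_norm_le_const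
      intro s hs
      apply intervalIntegral.norm_integral_le_of_norm_le_const
      intro u hu
      rw [Set.uIoc_of_le hc0.le] at hs hu
      have := hw (s+u) t (by linarith [hs.1, hu.1]) (by linarith [hs.2, hu.2]) ht
      rw [ge _ ht, ge (t + 2 * s + 2 * u) (by linarith [hs.1, hu.1]), ge (t + s + u) (by linarith [hs.1, hu.1])]
      rw [Real.norm_eq_abs, show t + 2 * s + 2 * u = t + 2 * (s+u) by ring, add_assoc t s u]
      exact this
    rw [e3, Real.norm_eq_abs, abs_mul, abs_of_pos (show 0 < c^2 by positivity), sub_zero, abs_of_pos hc0] at e4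
    have : 0 < c^2 := by positivity
    nlinarith
  -- Taylor
  refine ⟨D F1 m, fun t ht => ?_⟩
  have T1 : ∀ s ∈ Set.uIcc m t, |D F1 s - D F1 m| ≤ 9 * w / h^2 * |t - m| := by
    intro s hs
    have hs0 : Set.uIcc m t ⊆ Set.Ici 0 := fun y hy => by
      rw [Set.mem_uIcc] at hy; rcases hy with h | h <;> exact le_trans (by assumption) h.1
    have := (convex_uIcc m t).norm_image_sub_le_of_norm_hasDerivWithin_le (f := D F1) (f' := D g)
      (fun y _ => (dG1 y).hasDerivWithinAt) (fun y hy => bG y (hs0 hy)) Set.left_mem_uIcc hs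
    refine this.trans (mul_le_mul_of_nonneg_left ?_ (by positivity))
    exact Set.abs_sub_left_of_mem_uIcc hs
  have T2 := (convex_uIcc m t).norm_image_sub_le_of_norm_hasDerivWithin_le
      (f := fun s => D F2 s - D F1 m * s) (f' := fun s => D F1 s - D F1 m * 1)
      (fun y _ => ((dG y).sub ((hasDerivAt_id y).const_mul _)).hasDerivWithinAt)
      (fun y hy => by simpa using T1 y hy) Set.left_mem_uIcc Set.right_mem_uIcc
  rw [Real.norm_eq_abs, Real.norm_eq_abs, mul_assoc, ← sq, sq_abs] at T2
  have A := abs_le.1 (ap t ht)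
  have B := abs_le.1 (ap m hm)
  have T := abs_le.1 T2
  rw [abs_le]
  constructor <;> linarith [A.1, A.2, B.1, B.2, T.1, T.2]

set_option maxHeartbeats 2000000 in
theorem Top_direct_estimate (a : ℝ) (ha : 0 ≤ a) (α β : ℝ) (hα : 0 ≤ α) (hαβ : α ≤ β) :
    ∃ K : ℝ, 0 < K ∧ ∀ f : ℝ → ℝ, ContinuousOn f (Set.Ici 0) →
      (∃ C : ℝ, ∀ x : ℝ, 0 ≤ x → |f x| ≤ C) →
      ∀ n : ℕ, 1 ≤ n → ∀ x : ℝ, 0 ≤ x →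
        |TKS n a α β f x - f x| ≤
          K * omega2 f (Real.sqrt (TKS n a α β (fun t => (t - x) ^ 2) x +
              ((((n : ℝ) / ((n : ℝ) + β)) * x + (a / ((n : ℝ) + β)) * (x / (1 + x)) +
                  (2 * α + 1) / (2 * ((n : ℝ) + β))) - x) ^ 2)) +
            omega1 f ((β / ((n : ℝ) + β)) * x + (a / ((n : ℝ) + β)) * (x / (1 + x)) +
              (2 * α + 1) / (2 * ((n : ℝ) + β))) := by 
  refine ⟨20, by norm_num, ?_⟩
  rintro f hf ⟨C, hC⟩ n hn x hx
  have hn' : (1:ℝ) ≤ n := by exact_mod_cast hn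
  have hβ : 0 ≤ β := hα.trans hαβ
  have hN : 0 < (n:ℝ) + β := by linarith
  set N := (n:ℝ) + β with hNd
  set m := ((n : ℝ) / N) * x + (a / N) * (x / (1 + x)) + (2 * α + 1) / (2 * N) with hm
  set δ := (β / N) * x + (a / N) * (x / (1 + x)) + (2 * α + 1) / (2 * N) with hδ
  have hm0 : 0 ≤ m := by positivity
  set γ := TKS n a α β (fun t => (t - x) ^ 2) x + (m - x)^2 with hγ
  have C0 : 0 ≤ C := (abs_nonneg _).trans (hC 0 le_rfl)
  -- modulus bounds
  have hmx : m - x = (a / N) * (x / (1 + x)) + (2 * α + 1) / (2 * N) - (β / N) * x := by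
    have : (n:ℝ) / N = 1 - β / N := by rw [hNd]; field_simp; ring
    rw [hm, this]; ring
  have hab : |m - x| ≤ δ := by
    have h1 : 0 ≤ (a / N) * (x / (1 + x)) := by positivity
    have h2 : 0 ≤ (2 * α + 1) / (2 * N) := by positivity
    have h3 : 0 ≤ (β / N) * x := by positivity
    rw [hmx, abs_le, hδ]; constructor <;> linarith
  have bd1 : BddAbove {y | ∃ h x : ℝ, 0 < h ∧ h ≤ δ ∧ 0 ≤ x ∧ y = |f (x + h) - f x|} := by
    refine ⟨2 * C, ?_⟩
    rintro y ⟨h, x, h0, -, hx, rfl⟩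
    have A := abs_le.1 (hC x hx)
    have B := abs_le.1 (hC (x+h) (by linarith))
    rw [abs_le]; constructor <;> linarith [A.1, A.2, B.1, B.2]
  have om1 : |f m - f x| ≤ omega1 f δ := by
    rcases lt_trichotomy m x with h | h | h
    · apply le_csSup bd1
      refine ⟨x - m, m, by linarith, ?_, hm0, ?_⟩
      · rw [abs_sub_comm] at hab; exact (le_abs_self _).trans hab
      · rw [abs_sub_comm]; congr 3; ring
    · rw [h, sub_self, abs_zero]
      apply Real.sSup_nonneg
      rintro y ⟨h, x, h0, -, hx, rfl⟩; positivity
    · apply le_csSup bd1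
      refine ⟨m - x, x, by linarith, (le_abs_self _).trans hab, hx, ?_⟩
      congr 3; ring
  have om2 : ∀ h : ℝ, ∀ s x : ℝ, 0 < s → s ≤ h → 0 ≤ x →
      |f (x + 2 * s) - 2 * f (x + s) + f x| ≤ omega2 f h := by
    intro h s x hs hsh hx
    refine le_csSup ⟨4 * C, ?_⟩ ⟨s, x, hs, hsh, hx, rfl⟩
    rintro y ⟨h, x, h0, -, hx, rfl⟩
    have A := abs_le.1 (hC x hx)
    have B := abs_le.1 (hC (x+h) (by linarith))
    have D := abs_le.1 (hC (x+2*h) (by linarith))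
    rw [abs_le]; constructor <;> linarith [A.1, A.2, B.1, B.2, D.1, D.2]
  -- sums
  have W0 := fun k => W_nonneg n a ha k x hx
  have S0 := hasSum_W n hn a ha x hx
  have S1 := hasSum_W1 n hn a ha x hx
  have S2 := summable_W2 n hn a ha x hx
  set P : ℕ → ℝ := fun k => ((k:ℝ) + α) / N with hP
  set Q : ℕ → ℝ := fun k => ((k:ℝ) + α + 1) / N with hQ
  have PQ : ∀ k, Q k = P k + 1 / N := fun k => by simp only [hP, hQ]; ring
  have P0 : ∀ k, 0 ≤ P k := fun k => by positivity
  have PQl : ∀ k, P k ≤ Q k := fun k => by rw [PQ]; have : 0 < 1 / N := by positivity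
                                           linarith
  set s : ℕ → ℝ := fun k => ∫ t in (P k)..(Q k), (t - x)^2 with hs
  have sval : ∀ k, s k = 1 / N * ((P k - x)^2 + (P k - x) * (1/N) + (1/N)^2/3) := by
    intro k
    simp only [hs]
    rw [intervalIntegral.integral_comp_sub_right (fun t => t^2) x, integral_pow, PQ]
    push_cast; ring
  have sS : Summable (fun k => W n a k x * s k) := by
    have := ((S2.mul_left (1 / N * (1/N)^2)).add (S1.summable.mul_left
      (1/N * (2 * (1/N) * (α/N - x) + (1/N)^2)))).add (S0.summable.mul_left
      (1/N * ((α/N - x)^2 + (α/N - x) * (1/N) + (1/N)^2/3)))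
    refine this.congr ?_
    intro k
    rw [sval]; simp only [hP]; ring
  have sT : TKS n a α β (fun t => (t - x) ^ 2) x = N * ∑' k, W n a k x * s k := rfl
  have slb : ∀ k, (1/N)^3/12 ≤ s k := by
    intro k
    rw [sval]
    have : 0 < 1 / N := by positivity
    generalize 1 / N = d at *
    have := mul_nonneg this.le (sq_nonneg (P k - x + d/2))
    nlinarith
  have γpos : 0 < γ := by
    have : (1/N)^3/12 ≤ ∑' k, W n a k x * s k := by
      have h := (S0.mul_right ((1/N)^3/12))
      rw [one_mul] at h
      rw [← h.tsum_eq]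
      exact h.summable.tsum_le_tsum (fun k => mul_le_mul_of_nonneg_left (slb k) (W0 k)) sS
    have h3 : 0 < (1/N)^3/12 := by positivity
    have := mul_pos hN (h3.trans_le this)
    rw [hγ, sT]; positivity
  set h := Real.sqrt γ with hh
  have hpos : 0 < h := Real.sqrt_pos.2 γpos
  have h2 : h^2 = γ := Real.sq_sqrt γpos.le
  set w := omega2 f h with hw
  have w0 : 0 ≤ w := (abs_nonneg _).trans (om2 h h 0 hpos le_rfl le_rfl)
  obtain ⟨L, hL⟩ := steklov f hf h w hpos (by
    intro s x hs hsh hx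
    rcases hs.eq_or_lt with rfl | hs
    · simp only [mul_zero, add_zero]
      rw [show f x - 2 * f x + f x = 0 by ring, abs_zero]; exact w0
    · exact om2 h s x hs hsh hx) m hm0
  set B := 9 * w / h^2 with hB
  have B0 : 0 ≤ B := by positivity
  set A : ℕ → ℝ := fun k => ∫ t in (P k)..(Q k), f t with hA
  have fI : ∀ k, IntervalIntegrable f volume (P k) (Q k) := fun k =>
    (hf.mono (by rw [Set.uIcc_of_le (PQl k)]; exact fun t ht => (P0 k).trans ht.1)).intervalIntegrable
  have AS : Summable (fun k => W n a k x * A k) := by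
    refine Summable.of_norm_bounded (S0.summable.mul_right (C * (1/N))) ?_
    intro k
    rw [norm_mul, Real.norm_of_nonneg (W0 k)]
    refine mul_le_mul_of_nonneg_left ?_ (W0 k)
    have := intervalIntegral.norm_integral_le_of_norm_le_const (a := P k) (b := Q k) (f := f) (C := C) (by
      intro t ht
      rw [Set.uIoc_of_le (PQl k)] at ht
      exact hC t ((P0 k).trans ht.1.le))
    rw [PQ, add_sub_cancel_left, abs_of_pos (by positivity)] at this
    simp only [hA]; rw [PQ]; exact this
  -- linear part
  have lin : HasSum (fun k => W n a k x * (1/N * (P k + 1/N/2 - m))) 0 := by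
    have := (S1.mul_left (1/N * (1/N))).add (S0.mul_left (1/N * (α/N + 1/N/2 - m)))
    have e : 1/N * (1/N) * (n * x + a * (x/(1+x))) + 1/N * (α/N + 1/N/2 - m) * 1 = 0 := by
      rw [hm]; field_simp; ring
    rw [e] at this
    refine this.congr_fun ?_
    intro k
    simp only [hP]; ring
  have pt : ∀ k, |A k - f m * (1/N) - L * (1/N * (P k + 1/N/2 - m))| ≤
      2 * w * (1/N) + B * (2 * s k + 2 * (m-x)^2 * (1/N)) := by
    intro k
    have e1 : A k - f m * (1/N) - L * (1/N * (P k + 1/N/2 - m)) =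
        ∫ t in (P k)..(Q k), (f t - f m - L * (t - m)) := by
      rw [intervalIntegral.integral_sub ((fI k).sub (continuous_const.intervalIntegrable _ _))
        ((by fun_prop : Continuous fun t : ℝ => L * (t - m)).intervalIntegrable _ _),
        intervalIntegral.integral_sub (fI k) (continuous_const.intervalIntegrable _ _),
        intervalIntegral.integral_const_mul, intervalIntegral.integral_const,
        intervalIntegral.integral_comp_sub_right (fun t => t) m, integral_id, smul_eq_mul]
      simp only [hA]
      rw [PQ]; ring
    have e2 : 2 * w * (1/N) + B * (2 * s k + 2 * (m-x)^2 * (1/N)) =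
        ∫ t in (P k)..(Q k), (2 * w + B * (2 * (t-x)^2 + 2 * (m-x)^2)) := by
      rw [intervalIntegral.integral_add (continuous_const.intervalIntegrable _ _)
        ((by fun_prop : Continuous fun t : ℝ => B * (2 * (t-x)^2 + 2 * (m-x)^2)).intervalIntegrable _ _),
        intervalIntegral.integral_const_mul B,
        intervalIntegral.integral_add
        ((by fun_prop : Continuous fun t : ℝ => 2 * (t-x)^2).intervalIntegrable _ _)
        (continuous_const.intervalIntegrable _ _),
        intervalIntegral.integral_const_mul (2:ℝ) (fun t : ℝ => (t-x)^2), intervalIntegral.integral_const,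
        intervalIntegral.integral_const, smul_eq_mul, smul_eq_mul]
      simp only [hs]
      rw [PQ]; ring
    rw [e1, e2, ← Real.norm_eq_abs]
    apply intervalIntegral.norm_integral_le_of_norm_le (PQl k)
    · refine Filter.Eventually.of_forall fun t ht => ?_
      rw [Real.norm_eq_abs]
      refine (hL t ((P0 k).trans ht.1.le)).trans ?_
      have : (t - m)^2 ≤ 2 * (t-x)^2 + 2 * (m-x)^2 := by nlinarith [sq_nonneg ((t-x)+(m-x))]
      have := mul_le_mul_of_nonneg_left this B0
      linarith
    · exact (by fun_prop : Continuous fun t : ℝ => 2 * w + B * (2 * (t-x)^2 + 2 * (m-x)^2)).intervalIntegrable _ _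
  have big : |∑' k, W n a k x * A k - f m * (1/N)| ≤
      2 * w * (1/N) + B * (2 * (∑' k, W n a k x * s k) + 2 * (m-x)^2 * (1/N)) := by
    have H1 := (AS.hasSum.sub (S0.mul_right (f m * (1/N)))).sub (lin.mul_left L)
    have H2 := (S0.mul_right (2 * w * (1/N))).add
      (((sS.hasSum.mul_left 2).add (S0.mul_right (2 * (m-x)^2 * (1/N)))).mul_left B)
    rw [one_mul, mul_zero, sub_zero] at H1
    rw [one_mul, one_mul] at H2
    rw [← H1.tsum_eq, ← H2.tsum_eq, ← Real.norm_eq_abs]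
    apply tsum_of_norm_bounded H2.summable.hasSum
    intro k
    have := mul_le_mul_of_nonneg_left (pt k) (W0 k)
    rw [Real.norm_eq_abs, show W n a k x * A k - W n a k x * (f m * (1/N)) -
      L * (W n a k x * (1/N * (P k + 1/N/2 - m))) = W n a k x *
        (A k - f m * (1/N) - L * (1/N * (P k + 1/N/2 - m))) by ring, abs_mul, abs_of_nonneg (W0 k)]
    linarith
  have fin : |TKS n a α β f x - f m| ≤ 20 * w := by
    have e1 : TKS n a α β f x - f m = N * (∑' k, W n a k x * A k - f m * (1/N)) := by
      have : TKS n a α β f x = N * ∑' k, W n a k x * A k := rfl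
      rw [this]; field_simp
    rw [e1, abs_mul, abs_of_pos hN]
    refine (mul_le_mul_of_nonneg_left big hN.le).trans (le_of_eq ?_)
    have e2 : N * (2 * w * (1/N) + B * (2 * (∑' k, W n a k x * s k) + 2 * (m-x)^2 * (1/N))) =
        2 * w + B * (2 * γ) := by
      rw [hγ, sT]; field_simp
    rw [e2, hB, h2]; field_simp; ring
  calc |TKS n a α β f x - f x| = |(TKS n a α β f x - f m) + (f m - f x)| := by congr 1; ring
    _ ≤ _ := abs_add_le _ _
    _ ≤ _ := add_le_add fin om1
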